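/- arXiv:1504.00194 — 2 statements merged into one kernel-verified Lean document; each statement's English description precedes it below -/
import Mathlib

section
/- Suppose d ∈ F ∖ F₀, D = (K/F,σ,c) is a division algebra, m is prime, and, in case m ≠ 2 and m ≠ 3, F₀ contains a primitive m-th root of unity. If dⁿ is not of the form N_{F/F₀}(det λ(z)) for any z ∈ D ∖ {0} (i.e., dⁿ ∉ N_{D/F₀}(D^×)), then the tensor product algebra A = (L/F₀,σ,c) ⊗_{F₀} (F/F₀,τ,d) is a division algebra. -/
/-!
Setup: `K` is a field, `σ τ : K ≃+* K` are commuting automorphisms of orders `n`, `m`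
generating a group of order `n*m` (encoded by `hindep`); `F = Fix σ`, `L = Fix τ`,
`F₀ = Fix σ ∩ Fix τ`, so that `K/F₀` is Galois with group `⟨σ⟩ × ⟨τ⟩`.

`cycMul` is the multiplication of the associative cyclic algebra `D = (K/F,σ,c)` of degree `n`,
realized on `Fin n → K` (the coefficients w.r.t. the right `K`-basis `{1, e, …, e^{n-1}}`),
via `(eⁱ a)(eᵏ b) = e^{(i+k) % n} c^{(i+k)/n} σᵏ(a) b`.

`tenMul` is the multiplication of the tensor product algebra
`A = (L/F₀,σ,c) ⊗_{F₀} (F/F₀,τ,d)`, realized on `Fin n → Fin m → K`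
(the coefficients w.r.t. the `K`-basis `{eⁱ fʲ}`), via
`(eⁱfʲ a)(eᵏfˡ b) = e^{(i+k) % n} f^{(j+l) % m} c^{(i+k)/n} d^{(j+l)/m} σᵏ(τˡ(a)) b`.
-/

/-- Multiplication of the cyclic algebra `(K/F,σ,c)` on coefficients `Fin n → K`. -/
noncomputable def cycMul {K : Type*} [Field K] (n : ℕ) (σ : K ≃+* K) (c : K)
    (x y : Fin n → K) : Fin n → K :=
  fun r => ∑ i : Fin n, ∑ k : Fin n,
    if ((i : ℕ) + (k : ℕ)) % n = (r : ℕ) then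
      c ^ (((i : ℕ) + (k : ℕ)) / n) * (σ ^ (k : ℕ)) (x i) * y k
    else 0

/-- Multiplication of the tensor product algebra `(L/F₀,σ,c) ⊗_{F₀} (F/F₀,τ,d)` on
coefficients `Fin n → Fin m → K`. -/
noncomputable def tenMul {K : Type*} [Field K] (n m : ℕ) (σ τ : K ≃+* K) (c d : K)
    (x y : Fin n → Fin m → K) : Fin n → Fin m → K :=
  fun r s => ∑ i : Fin n, ∑ j : Fin m, ∑ k : Fin n, ∑ l : Fin m,
    if ((i : ℕ) + (k : ℕ)) % n = (r : ℕ) ∧ ((j : ℕ) + (l : ℕ)) % m = (s : ℕ) then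
      c ^ (((i : ℕ) + (k : ℕ)) / n) * d ^ (((j : ℕ) + (l : ℕ)) / m) *
        (σ ^ (k : ℕ)) ((τ ^ (l : ℕ)) (x i j)) * y k l
    else 0

/-- The scalar `d ∈ K` viewed as the element `e⁰ d` of the cyclic algebra. -/
noncomputable def delta0 {K : Type*} [Field K] (n : ℕ) (d : K) : Fin n → K :=
  fun i => if (i : ℕ) = 0 then d else 0

/-- The (left-associated) product `z · τ̃(z) · τ̃²(z) ⋯ τ̃^{j-1}(z)` in the cyclic algebra
`D = (K/F,σ,c)`, where `τ̃` applies `τ` to each `K`-coefficient. -/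
noncomputable def zProd {K : Type*} [Field K] (n : ℕ) (σ τ : K ≃+* K) (c : K)
    (z : Fin n → K) : ℕ → (Fin n → K)
  | 0 => delta0 n 1
  | (j + 1) => cycMul n σ c (zProd n σ τ c z j) (fun i => (τ ^ j) (z i))

/-- The matrix `λ(z) ∈ Mat_n(K)` of left multiplication by `z ∈ D = (K/F,σ,c)` with respect
to the right `K`-basis `{1, e, …, e^{n−1}}`. -/
noncomputable def lam {K : Type*} [Field K] (n : ℕ) (σ : K ≃+* K) (c : K) (z : Fin n → K) :
    Matrix (Fin n) (Fin n) K :=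
  fun r k => cycMul n σ c z (fun i => if i = k then 1 else 0) r

/-- The additive map of `Rⁿ` given by left multiplication by `eʲ`, where `eⁿ = c`. -/
def cycShift {R : Type*} [Ring R] (n : ℕ) (c : R) (j : ℕ) : AddMonoid.End (Fin n → R) where
  toFun v r := ∑ l : Fin n, if (j + (l : ℕ)) % n = r then c ^ ((j + (l : ℕ)) / n) * v l else 0
  map_zero' := by ext; simp
  map_add' v w := by
    ext r
    simp only [Pi.add_apply, ← Finset.sum_add_distrib]
    refine Finset.sum_congr rfl fun l _ => ?_
    split_ifs <;> simp [mul_add]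

theorem cycShift_apply {R : Type*} [Ring R] (n : ℕ) (c : R) (j : ℕ) (v : Fin n → R) (r : Fin n) :
    cycShift n c j v r =
      ∑ l : Fin n, if (j + (l : ℕ)) % n = r then c ^ ((j + (l : ℕ)) / n) * v l else 0 :=
  rfl

theorem sum_ite_mod_eq {M : Type*} [AddCommMonoid M] {n : ℕ} (hn : 0 < n) (k : ℕ)
    (g : Fin n → M) :
    (∑ p : Fin n, if k % n = (p : ℕ) then g p else 0) = g ⟨k % n, Nat.mod_lt k hn⟩ := by
  rw [Finset.sum_eq_single ⟨k % n, Nat.mod_lt k hn⟩]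
  · simp
  · intro b _ hb
    rw [if_neg]
    exact fun h => hb (Fin.ext h.symm)
  · simp

theorem cycShift_single {R : Type*} [Ring R] {n : ℕ} (hn : 0 < n) (c : R) (j : ℕ) (l : Fin n)
    (a : R) :
    cycShift n c j (Pi.single l a) =
      Pi.single ⟨(j + l) % n, Nat.mod_lt _ hn⟩ (c ^ ((j + (l : ℕ)) / n) * a) := by
  ext r
  rw [cycShift_apply, Finset.sum_eq_single l]
  · simp only [Pi.single_eq_same, Pi.single_apply, Fin.ext_iff, eq_comm]
  · intro b _ hb
    simp [hb]
  · simp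

theorem cycShift_add {R : Type*} [Ring R] {n : ℕ} (hn : 0 < n) (c : R) (j k : ℕ) :
    cycShift n c (j + k) = cycShift n c j * cycShift n c k := by
  refine AddMonoidHom.functions_ext' _ _ _ fun l => ?_
  ext1 a
  change cycShift n c (j + k) (Pi.single l a) = cycShift n c j (cycShift n c k (Pi.single l a))
  have hdiv : (j + (k + l) % n) / n + (k + l) / n = (j + k + l) / n := by
    conv_rhs => rw [add_assoc, ← Nat.mod_add_div (k + l) n, ← add_assoc,
      Nat.add_mul_div_left _ _ hn]
  rw [cycShift_single hn, cycShift_single hn, cycShift_single hn, ← mul_assoc, ← pow_add, hdiv]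
  simp [add_assoc]

theorem cycShift_zero {R : Type*} [Ring R] (n : ℕ) (c : R) : cycShift n c 0 = 1 := by
  ext v r
  rw [cycShift_apply, Finset.sum_eq_single r]
  · simp [Nat.mod_eq_of_lt r.2, Nat.div_eq_of_lt r.2]
  · intro b _ hb
    rw [if_neg]
    rw [zero_add, Nat.mod_eq_of_lt b.2]
    exact fun h => hb (Fin.ext h)
  · simp

theorem cycShift_one_pow {R : Type*} [Ring R] {n : ℕ} (hn : 0 < n) (c : R) (j : ℕ) :
    cycShift n c 1 ^ j = cycShift n c j := by
  induction j with
  | zero => rw [pow_zero, cycShift_zero]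
  | succ j ih => rw [pow_succ, ih, ← cycShift_add hn]

theorem cycShift_self {R : Type*} [Ring R] {n : ℕ} (c : R) (v : Fin n → R) (r : Fin n) :
    cycShift n c n v r = c * v r := by
  have hn : 0 < n := r.pos
  rw [cycShift_apply, Finset.sum_eq_single r]
  · simp [Nat.mod_eq_of_lt r.2, Nat.div_eq_of_lt r.2, hn]
  · intro b _ hb
    rw [if_neg]
    rw [Nat.add_mod_left, Nat.mod_eq_of_lt b.2]
    exact fun h => hb (Fin.ext h)
  · simp

/-- The embedding `a ↦ (a, σ a, …, σⁿ⁻¹ a)` of `R` into `Rⁿ`. -/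
def cycTwist {R : Type*} [Ring R] (n : ℕ) (σ : R ≃+* R) : R →+* (Fin n → R) :=
  RingHom.pi fun k => ((σ ^ (k : ℕ) : R ≃+* R) : R →+* R)

theorem cycTwist_apply {R : Type*} [Ring R] (n : ℕ) (σ : R ≃+* R) (a : R) (k : Fin n) :
    cycTwist n σ a k = (σ ^ (k : ℕ)) a :=
  rfl

theorem pow_apply_of_fixed {R : Type*} [Ring R] {σ : R ≃+* R} {c : R} (h : σ c = c) (k : ℕ) :
    (σ ^ k) c = c := by
  induction k with
  | zero => rfl
  | succ k ih => rw [pow_succ, RingAut.mul_apply, h, ih]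

theorem cycTwist_mul_cycShift {R : Type*} [Ring R] {n : ℕ} {σ : R ≃+* R}
    (hσ : σ ^ n = 1) {c : R} (hc : ∀ a, a * c = c * a) (j : ℕ) (a : R) (v : Fin n → R) :
    cycTwist n σ a * cycShift n c j v = cycShift n c j (cycTwist n σ ((σ ^ j) a) * v) := by
  ext r
  simp only [Pi.mul_apply, cycShift_apply, Finset.mul_sum, cycTwist_apply]
  refine Finset.sum_congr rfl fun l _ => ?_
  split_ifs with h
  · have : (σ ^ (l : ℕ)) ((σ ^ j) a) = (σ ^ (r : ℕ)) a := by
      rw [← RingAut.mul_apply, ← pow_add, ← h, ← pow_mod_orderOf, ← pow_mod_orderOf σ (_ % n),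
        Nat.mod_mod_of_dvd _ (orderOf_dvd_of_pow_eq_one hσ), add_comm]
    have hcomm : Commute ((σ ^ (r : ℕ)) a) (c ^ ((j + (l : ℕ)) / n)) := Commute.pow_right (hc _) _
    rw [this, ← mul_assoc, hcomm.eq, mul_assoc]
  · simp

/-- The product of `Σ eⁱ xᵢ` and `Σ eᵏ yₖ` in the cyclic algebra over `R` defined by `σ` and
`c`. -/
def skewMul {R : Type*} [Ring R] (n : ℕ) (σ : R ≃+* R) (c : R) (x y : Fin n → R) : Fin n → R :=
  ∑ i : Fin n, cycShift n c i (cycTwist n σ (x i) * y)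

theorem skewMul_apply {R : Type*} [Ring R] (n : ℕ) (σ : R ≃+* R) (c : R) (x y : Fin n → R)
    (r : Fin n) :
    skewMul n σ c x y r = ∑ i : Fin n, ∑ k : Fin n,
      if ((i : ℕ) + (k : ℕ)) % n = (r : ℕ) then
        c ^ (((i : ℕ) + (k : ℕ)) / n) * (σ ^ (k : ℕ)) (x i) * y k
      else 0 := by
  simp only [skewMul, Finset.sum_apply, cycShift_apply, Pi.mul_apply, cycTwist_apply, mul_assoc]

theorem cycMul_eq_skewMul {K : Type*} [Field K] (n : ℕ) (σ : K ≃+* K) (c : K) :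
    cycMul n σ c = skewMul n σ c := by
  ext x y r
  rw [skewMul_apply, cycMul]

theorem skewMul_add {R : Type*} [Ring R] (n : ℕ) (σ : R ≃+* R) (c : R) (x y z : Fin n → R) :
    skewMul n σ c x (y + z) = skewMul n σ c x y + skewMul n σ c x z := by
  simp [skewMul, mul_add, Finset.sum_add_distrib]

theorem add_skewMul {R : Type*} [Ring R] (n : ℕ) (σ : R ≃+* R) (c : R) (x y z : Fin n → R) :
    skewMul n σ c (x + y) z = skewMul n σ c x z + skewMul n σ c y z := by
  simp [skewMul, add_mul, Finset.sum_add_distrib]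

theorem cycShift_mod {R : Type*} [Ring R] {n : ℕ} (hn : 0 < n) {σ : R ≃+* R} {c : R}
    (hσc : σ c = c) (j : ℕ) (v : Fin n → R) :
    cycShift n c (j % n) (cycTwist n σ (c ^ (j / n)) * v) = cycShift n c j v := by
  ext r
  have hpow (l k : ℕ) : (σ ^ l) (c ^ k) = c ^ k := by rw [map_pow, pow_apply_of_fixed hσc]
  simp only [cycShift_apply, Pi.mul_apply, cycTwist_apply, hpow, ← mul_assoc, ← pow_add]
  refine Finset.sum_congr rfl fun l _ => ?_
  have hdiv : (j % n + l) / n + j / n = (j + l) / n := by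
    conv_rhs => rw [← Nat.mod_add_div j n, add_right_comm, Nat.add_mul_div_left _ _ hn]
  rw [hdiv, Nat.mod_add_mod]

theorem skewMul_assoc {R : Type*} [Ring R] {n : ℕ} (hn : 0 < n) {σ : R ≃+* R}
    (hσ : σ ^ n = 1) {c : R} (hc : ∀ a, a * c = c * a) (hσc : σ c = c) (x y z : Fin n → R) :
    skewMul n σ c (skewMul n σ c x y) z = skewMul n σ c x (skewMul n σ c y z) := by
  have hl : skewMul n σ c (skewMul n σ c x y) z = ∑ i : Fin n, ∑ k : Fin n,
      cycShift n c (i + k) (cycTwist n σ ((σ ^ (k : ℕ)) (x i) * y k) * z) := by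
    rw [skewMul]
    simp only [skewMul_apply, map_sum, Finset.sum_mul, apply_ite (cycTwist n σ), map_zero,
      ite_mul, zero_mul, apply_ite (cycShift n c _)]
    rw [Finset.sum_comm]
    refine Finset.sum_congr rfl fun i _ => ?_
    rw [Finset.sum_comm]
    refine Finset.sum_congr rfl fun k _ => ?_
    rw [sum_ite_mod_eq hn, mul_assoc, map_mul (cycTwist n σ), mul_assoc]
    exact cycShift_mod hn hσc _ _
  rw [hl]
  conv_rhs => rw [skewMul]
  refine Finset.sum_congr rfl fun i _ => ?_
  rw [skewMul, Finset.mul_sum, map_sum]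
  refine Finset.sum_congr rfl fun k _ => ?_
  rw [cycTwist_mul_cycShift hσ hc, cycShift_add hn, map_mul (cycTwist n σ), mul_assoc]
  rfl

theorem linearIndependent_pow_of_irreducible {D V : Type*} [DivisionRing D] [AddCommGroup V]
    [Module D V] {m : ℕ} {b : Fin m → V} (hb : LinearIndependent D b) (T : AddMonoid.End V)
    (θ : D → D) (hT : ∀ a v, T (a • v) = θ a • T v)
    (hirr : ∀ W : Submodule D V, (∀ v ∈ W, T v ∈ W) → W ≠ ⊥ → W = ⊤) {y : V} (hy : y ≠ 0) :
    LinearIndependent D fun j : Fin m => (T ^ (j : ℕ)) y := by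
  classical
  have key (k : ℕ) (hk : k < m) :
      (T ^ k) y ∉ Submodule.span D ((Finset.range k).image fun j => (T ^ j) y : Set V) := by
    intro hmem
    set W := Submodule.span D ((Finset.range k).image fun j => (T ^ j) y : Set V) with hW
    have hgen (j : ℕ) (hj : j ≤ k) : (T ^ j) y ∈ W := by
      rcases hj.lt_or_eq with h | rfl
      · exact Submodule.subset_span (Finset.mem_coe.2 (Finset.mem_image_of_mem _ (by simpa)))
      · exact hmem
    have hstable : ∀ v ∈ W, T v ∈ W := by
      intro v hv
      induction hv using Submodule.span_induction with
      | mem v hv =>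
        obtain ⟨j, hj, rfl⟩ := Finset.mem_image.1 (Finset.mem_coe.1 hv)
        have := hgen (j + 1) (Finset.mem_range.1 hj)
        rwa [pow_succ'] at this
      | zero => simp
      | add v w _ _ hv hw => rw [map_add]; exact W.add_mem hv hw
      | smul a v _ hv => rw [hT]; exact W.smul_mem _ hv
    have htop : W = ⊤ := hirr W hstable fun h => hy <| by
      simpa [h] using hgen 0 (Nat.zero_le k)
    have hcard := linearIndependent_le_span_finset b hb _ htop
    rw [Cardinal.mk_fin, Nat.cast_le] at hcard
    have := hcard.trans Finset.card_image_le
    rw [Finset.card_range] at this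
    omega
  rw [Fintype.linearIndependent_iff]
  intro g hg
  by_contra! hne
  obtain ⟨i, hi, hmax⟩ := Finset.exists_max_image (Finset.univ.filter fun i => g i ≠ 0) id
    (by simpa [Finset.Nonempty] using hne)
  rw [Finset.mem_filter] at hi
  refine key i i.2 ?_
  rw [← Finset.add_sum_erase _ _ (Finset.mem_univ i)] at hg
  rw [← inv_smul_smul₀ hi.2 ((T ^ (i : ℕ)) y), eq_neg_of_add_eq_zero_left hg]
  refine Submodule.smul_mem _ _ (Submodule.neg_mem _ (Submodule.sum_mem _ fun j hj => ?_))
  by_cases hgj : g j = 0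
  · simp [hgj]
  · refine Submodule.smul_mem _ _ (Submodule.subset_span (Finset.mem_coe.2
      (Finset.mem_image_of_mem _ (Finset.mem_range.2 ?_))))
    exact lt_of_le_of_ne (hmax j (by simp [hgj])) fun h => (Finset.mem_erase.1 hj).1 (Fin.ext h)

/-- The skew module of a nonassociative cyclic algebra has no proper nonzero submodules when the
conjugates of `d` are distinct. -/
theorem eq_top_of_cycShift_mem {D : Type*} [DivisionRing D] {m : ℕ} {τ : D ≃+* D} {d : D}
    (hd0 : d ≠ 0) (hinj : Function.Injective fun l : Fin m => (τ ^ (l : ℕ)) d)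
    (W : AddSubgroup (Fin m → D)) (hsmul : ∀ a, ∀ v ∈ W, cycTwist m τ a * v ∈ W)
    (hshift : ∀ v ∈ W, cycShift m d 1 v ∈ W) (hW : W ≠ ⊥) : W = ⊤ := by
  classical
  have hshift' (j : ℕ) (hm : 0 < m) : ∀ v ∈ W, cycShift m d j v ∈ W := by
    induction j with
    | zero => intro v hv; rw [cycShift_zero]; exact hv
    | succ j ih => intro v hv; rw [cycShift_add hm]; exact ih _ (hshift v hv)
  let supp (v : Fin m → D) : Finset (Fin m) := Finset.univ.filter fun l => v l ≠ 0
  have hmem_supp (v : Fin m → D) (l : Fin m) : l ∈ supp v ↔ v l ≠ 0 := by simp [supp]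
  obtain ⟨⟨v₀, hv₀⟩, hv₀0⟩ := AddSubgroup.ne_bot_iff_exists_ne_zero.1 hW
  obtain ⟨w, ⟨hw, hw0⟩, hmin⟩ := exists_minimalFor_of_wellFoundedLT
    (fun v : Fin m → D => v ∈ W ∧ v ≠ 0) (fun v => (supp v).card) ⟨v₀, hv₀, fun h => hv₀0 (Subtype.ext h)⟩
  obtain ⟨p, hp⟩ := Function.ne_iff.1 hw0
  have hm : 0 < m := p.pos
  have hsingle : w = Pi.single p (w p) := by
    ext q
    by_cases hqp : q = p
    · subst hqp; simp
    rw [Pi.single_eq_of_ne hqp]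
    by_contra hq
    set e := (τ ^ (p : ℕ)).symm d
    have he (l : Fin m) : (τ ^ (l : ℕ)) e = d ↔ l = p := by
      rw [← (hinj.eq_iff (a := l) (b := p)), ← (τ ^ (p : ℕ)).injective.eq_iff,
        ← RingAut.mul_apply, pow_mul_comm, RingAut.mul_apply, RingEquiv.apply_symm_apply]
    let u := cycShift m d m w - cycTwist m τ e * w
    have hu (l : Fin m) : u l = (d - (τ ^ (l : ℕ)) e) * w l := by
      simp [u, cycShift_self, cycTwist_apply, sub_mul]
    have huW : u ∈ W := W.sub_mem (hshift' m hm w hw) (hsmul e w hw)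
    have huq : u q ≠ 0 := by
      rw [hu]
      exact mul_ne_zero (sub_ne_zero.2 fun h => hqp ((he q).1 h.symm)) hq
    have hlt : (supp u).card < (supp w).card := by
      refine Finset.card_lt_card (Finset.ssubset_iff_of_subset ?_ |>.2 ⟨p, ?_, ?_⟩)
      · intro l
        rw [hmem_supp, hmem_supp, hu]
        exact right_ne_zero_of_mul
      · rwa [hmem_supp]
      · rw [hmem_supp, hu, (he p).2 rfl]
        simp
    exact hlt.not_ge (hmin ⟨huW, fun h => huq (by simp [h])⟩ hlt.le)
  have hall (i : Fin m) (a : D) : Pi.single i a ∈ W := by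
    have h := hshift' (i + (m - p)) hm w hw
    have hi : (⟨(i + (m - p) + p) % m, Nat.mod_lt _ hm⟩ : Fin m) = i := by
      ext
      simp only
      rw [add_assoc, Nat.sub_add_cancel p.2.le, Nat.add_mod_right, Nat.mod_eq_of_lt i.2]
    rw [hsingle, cycShift_single hm, hi] at h
    set f := d ^ ((i + (m - p) + (p : ℕ)) / m) * w p
    have hf : f ≠ 0 := mul_ne_zero (pow_ne_zero _ hd0) hp
    have h' := hsmul ((τ ^ (i : ℕ)).symm (a * f⁻¹)) _ h
    convert h' using 1
    ext l
    by_cases hl : l = i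
    · subst hl
      simp [cycTwist_apply, hf]
    · simp [hl]
  refine eq_top_iff.2 fun v _ => ?_
  rw [← Finset.univ_sum_single v]
  exact W.sum_mem fun i _ => hall i (v i)

theorem skewMul_ne_zero {D : Type*} [DivisionRing D] {m : ℕ} {τ : D ≃+* D} (hτ : τ ^ m = 1)
    {d : D} (hd0 : d ≠ 0) (hd : ∀ a, a * d = d * a)
    (hinj : Function.Injective fun l : Fin m => (τ ^ (l : ℕ)) d) {x y : Fin m → D} (hx : x ≠ 0)
    (hy : y ≠ 0) : skewMul m τ d x y ≠ 0 := by
  let twisted : Module D (Fin m → D) := Module.compHom (Fin m → D) (cycTwist m τ)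
  let : SMul D (Fin m → D) := twisted.toSMul
  have hsmul (a : D) (v : Fin m → D) : a • v = cycTwist m τ a * v := rfl
  obtain ⟨p, hp⟩ := Function.ne_iff.1 hx
  have hm : 0 < m := p.pos
  have hT (j : ℕ) (a : D) (v : Fin m → D) :
      cycShift m d j (a • v) = (τ ^ j).symm a • cycShift m d j v := by
    rw [hsmul, hsmul, cycTwist_mul_cycShift hτ hd, RingEquiv.apply_symm_apply]
  have hb : LinearIndependent D fun i : Fin m => (Pi.single i 1 : Fin m → D) := by
    rw [Fintype.linearIndependent_iff]
    intro g hg i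
    refine (map_eq_zero_iff _ (τ ^ (i : ℕ)).injective).1 ?_
    simpa [hsmul, Finset.sum_apply, Pi.single_apply, cycTwist_apply] using congrFun hg i
  have hli := linearIndependent_pow_of_irreducible hb (cycShift m d 1) _ (hT 1)
    (fun W hWT hW => by
      refine (Submodule.toAddSubgroup_injective ?_ : W = ⊤)
      refine eq_top_of_cycShift_mem hd0 hinj W.toAddSubgroup
        (fun a v hv => W.smul_mem a hv) hWT fun h => hW ?_
      exact Submodule.toAddSubgroup_injective h) hy
  simp only [cycShift_one_pow hm] at hli
  rw [Fintype.linearIndependent_iff] at hli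
  intro h
  refine hp ((map_eq_zero_iff _ (τ ^ (p : ℕ)).symm.injective).1
    (hli (fun j => (τ ^ (j : ℕ)).symm (x j)) ?_ p))
  rw [← h, skewMul]
  exact Finset.sum_congr rfl fun j _ => (hT j (x j) y).symm

theorem cycTwist_fixed {R : Type*} [Ring R] (n : ℕ) {σ : R ≃+* R} {d : R} (h : σ d = d) :
    cycTwist n σ d = fun _ => d :=
  funext fun k => pow_apply_of_fixed h k

theorem delta0_eq {K : Type*} [Field K] {n : ℕ} (hn : 0 < n) (d : K) :
    delta0 n d = Pi.single ⟨0, hn⟩ d := by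
  ext i
  simp [delta0, Pi.single_apply, Fin.ext_iff]

theorem delta0_skewMul {K : Type*} [Field K] {n : ℕ} (hn : 0 < n) {σ : K ≃+* K} (c : K) {d : K}
    (hd : σ d = d) (x : Fin n → K) : skewMul n σ c (delta0 n d) x = d • x := by
  rw [delta0_eq hn, skewMul, Finset.sum_eq_single ⟨0, hn⟩]
  · rw [Pi.single_eq_same, cycShift_zero, cycTwist_fixed n hd]
    rfl
  · intro i _ hi
    simp [hi]
  · simp

theorem skewMul_delta0 {K : Type*} [Field K] {n : ℕ} (hn : 0 < n) (σ : K ≃+* K) (c d : K)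
    (x : Fin n → K) : skewMul n σ c x (delta0 n d) = d • x := by
  rw [delta0_eq hn]
  ext r
  rw [skewMul_apply, Finset.sum_eq_single r, Finset.sum_eq_single ⟨0, hn⟩]
  · simp [Nat.mod_eq_of_lt r.2, Nat.div_eq_of_lt r.2, mul_comm]
  · intro k _ hk
    simp [hk]
  · simp
  · intro i _ hi
    refine Finset.sum_eq_zero fun k _ => ?_
    by_cases hk : k = ⟨0, hn⟩
    · subst hk
      rw [if_neg]
      rw [add_zero, Nat.mod_eq_of_lt i.2]
      exact fun h => hi (Fin.ext h)
    · simp [hk]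
  · simp

theorem skewMul_smul {K : Type*} [Field K] (n : ℕ) (σ : K ≃+* K) (c a : K)
    (x y : Fin n → K) : skewMul n σ c x (a • y) = a • skewMul n σ c x y := by
  ext r
  simp only [skewMul_apply, Pi.smul_apply, smul_eq_mul, Finset.mul_sum, mul_ite, mul_zero]
  refine Finset.sum_congr rfl fun i _ => Finset.sum_congr rfl fun k _ => ?_
  congr 1
  ring

theorem skewMul_map {K : Type*} [Field K] (n : ℕ) {σ τ : K ≃+* K} (hcomm : Commute σ τ) {c : K}
    (hc : τ c = c) (x y : Fin n → K) :
    (fun i => τ (skewMul n σ c x y i)) = skewMul n σ c (fun i => τ (x i)) fun i => τ (y i) := by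
  have hστ (k : ℕ) (a : K) : τ ((σ ^ k) a) = (σ ^ k) (τ a) := by
    rw [← RingAut.mul_apply, ← (hcomm.pow_left k).eq, RingAut.mul_apply]
  ext r
  simp only [skewMul_apply, map_sum, apply_ite τ, map_mul, map_pow, map_zero, hc, hστ]

/-- The underlying additive group of a cyclic algebra of degree `n`, without the pointwise
multiplication of `Fin n → K`. -/
def CycAlg (K : Type*) (n : ℕ) : Type _ :=
  Fin n → K

instance {K : Type*} [Field K] {n : ℕ} : AddCommGroup (CycAlg K n) :=
  inferInstanceAs (AddCommGroup (Fin n → K))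

/-- A cyclic algebra without zero divisors is a division ring. -/
theorem exists_divisionRing_cycMul.{u} {K : Type u} [Field K] {n : ℕ} (hn : 0 < n)
    {σ : K ≃+* K} (hσ : σ ^ n = 1) {c : K} (hσc : σ c = c)
    (hD : ∀ x y : Fin n → K, x ≠ 0 → y ≠ 0 → cycMul n σ c x y ≠ 0) :
    ∃ (D : Type u) (_ : DivisionRing D) (φ : (Fin n → K) ≃+ D),
      ∀ x y, φ (cycMul n σ c x y) = φ x * φ y := by
  rw [cycMul_eq_skewMul] at hD ⊢
  have hzero (x : Fin n → K) : skewMul n σ c x 0 = 0 := by simp [skewMul]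
  have zero_h (x : Fin n → K) : skewMul n σ c 0 x = 0 := by simp [skewMul]
  have one_h (x : Fin n → K) : skewMul n σ c (delta0 n 1) x = x := by
    rw [delta0_skewMul hn c (map_one σ), one_smul]
  have h_one (x : Fin n → K) : skewMul n σ c x (delta0 n 1) = x := by
    rw [skewMul_delta0 hn, one_smul]
  have hone : delta0 n (1 : K) ≠ 0 := fun h => by
    simpa [delta0] using congrFun h ⟨0, hn⟩
  have hinv (x : Fin n → K) (hx : x ≠ 0) : ∃ y, skewMul n σ c x y = delta0 n 1 := by
    let f : (Fin n → K) →ₗ[K] (Fin n → K) :=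
      { toFun := skewMul n σ c x
        map_add' := skewMul_add n σ c x
        map_smul' := fun a y => skewMul_smul n σ c a x y }
    have hf : Function.Injective f := (injective_iff_map_eq_zero f).2 fun y hy =>
      by_contra fun hy0 => hD x y hx hy0 hy
    exact LinearMap.injective_iff_surjective.1 hf _
  choose! inv hinv using hinv
  have inv_h (x : Fin n → K) (hx : x ≠ 0) : skewMul n σ c (inv x) x = delta0 n 1 := by
    have hne : inv x ≠ 0 := fun h => hone <| by rw [← hinv x hx, h, hzero]
    have hxx : inv (inv x) = x := by
      rw [← one_h (inv (inv x)), ← hinv x hx, skewMul_assoc hn hσ (fun a => mul_comm a c) hσc,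
        hinv _ hne, h_one]
    simpa [hxx] using hinv _ hne
  let R : Ring (CycAlg K n) :=
    { (inferInstance : AddCommGroup (CycAlg K n)) with
      mul := skewMul n σ c
      one := delta0 n 1
      left_distrib := skewMul_add n σ c
      right_distrib := add_skewMul n σ c
      zero_mul := zero_h
      mul_zero := hzero
      mul_assoc := skewMul_assoc hn hσ (fun a => mul_comm a c) hσc
      one_mul := one_h
      mul_one := h_one }
  have : Nontrivial (CycAlg K n) := ⟨_, _, hone⟩
  let D : DivisionRing (CycAlg K n) := .ofIsUnitOrEqZero fun x => or_iff_not_imp_right.2 fun hx =>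
    ⟨⟨x, inv x, hinv x hx, inv_h x hx⟩, rfl⟩
  exact ⟨CycAlg K n, D, AddEquiv.refl _, fun _ _ => rfl⟩

theorem injective_pow_apply_of_prime {K : Type*} [Field K] {m : ℕ} (hm : m.Prime) {τ : K ≃+* K}
    (hτ : τ ^ m = 1) {d : K} (hd : τ d ≠ d) :
    Function.Injective fun l : Fin m => (τ ^ (l : ℕ)) d := by
  have : Fact m.Prime := ⟨hm⟩
  have hpow (k : ℕ) : (τ ^ k) d = τ^[k] d := by simp
  have hper : Function.minimalPeriod τ d = m := Function.minimalPeriod_eq_prime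
    (by rw [Function.IsPeriodicPt, Function.IsFixedPt, ← hpow, hτ, RingAut.one_apply]) hd
  intro k l hkl
  simp only [hpow] at hkl
  exact Fin.ext (Function.iterate_injOn_Iio_minimalPeriod (by simp [hper]) (by simp [hper]) hkl)

/-- Suppose `d ∈ F ∖ F₀`, `D = (K/F,σ,c)` is a division algebra, `m` is
prime, and, in case `m ≠ 2, 3`, `F₀` contains a primitive `m`-th root of unity. If `dⁿ` is not
of the form `N_{F/F₀}(det λ(z)) = ∏_{j<m} τʲ(det λ(z))` for any nonzero `z ∈ D` (i.e.
`dⁿ ∉ N_{D/F₀}(D^×)`), then `A = (L/F₀,σ,c) ⊗_{F₀} (F/F₀,τ,d)` is a division algebra. -/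
theorem tensor_division_of_not_norm {K : Type*} [Field K] (n m : ℕ)
    (hn : 0 < n) (hmp : m.Prime)
    (σ τ : K ≃+* K) (hσord : orderOf σ = n) (hτord : orderOf τ = m)
    (hcomm : σ * τ = τ * σ)
    (hindep : ∀ i j : ℕ, i < n → j < m → σ ^ i * τ ^ j = 1 → i = 0 ∧ j = 0)
    (hroot : m ≠ 2 → m ≠ 3 → ∃ ζ : K, σ ζ = ζ ∧ τ ζ = ζ ∧ ζ ^ m = 1 ∧
      ∀ k : ℕ, 0 < k → k < m → ζ ^ k ≠ 1)
    (c : K) (hc0 : c ≠ 0) (hcσ : σ c = c) (hcτ : τ c = c)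
    (d : K) (hd0 : d ≠ 0) (hdσ : σ d = d) (hdτ : τ d ≠ d)
    (hD : ∀ x y : Fin n → K, x ≠ 0 → y ≠ 0 → cycMul n σ c x y ≠ 0)
    (hdn : ∀ z : Fin n → K, z ≠ 0 →
      d ^ n ≠ ∏ j ∈ Finset.range m, (τ ^ j) ((lam n σ c z).det)) :
    ∀ x y : Fin n → Fin m → K, x ≠ 0 → y ≠ 0 → tenMul n m σ τ c d x y ≠ 0 := by
  have hm := hmp.pos
  have hσ : σ ^ n = 1 := hσord ▸ pow_orderOf_eq_one σ
  have hτ : τ ^ m = 1 := hτord ▸ pow_orderOf_eq_one τ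
  have hτinj := injective_pow_apply_of_prime hmp hτ hdτ
  obtain ⟨D, _, φ, hφ⟩ := exists_divisionRing_cycMul hn hσ hcσ hD
  rw [cycMul_eq_skewMul] at hφ
  let τD : D ≃+* D :=
    { (φ.symm.trans (AddEquiv.piCongrRight fun _ => τ.toAddEquiv)).trans φ with
      map_mul' := fun a b => by
        obtain ⟨a, rfl⟩ := φ.surjective a
        obtain ⟨b, rfl⟩ := φ.surjective b
        change φ (fun i => τ (φ.symm (φ a * φ b) i)) =
          φ (fun i => τ (φ.symm (φ a) i)) * φ (fun i => τ (φ.symm (φ b) i))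
        simp only [← hφ, AddEquiv.symm_apply_apply, skewMul_map n hcomm hcτ] }
  have hτD1 (v : Fin n → K) : τD (φ v) = φ fun i => τ (v i) := by
    change φ (fun i => τ (φ.symm (φ v) i)) = _
    rw [φ.symm_apply_apply]
  have hτD (k : ℕ) (v : Fin n → K) : (τD ^ k) (φ v) = φ fun i => (τ ^ k) (v i) := by
    induction k with
    | zero => rfl
    | succ k ih => simp only [pow_succ', RingAut.mul_apply, ih, hτD1]
  have hτDm : τD ^ m = 1 := by
    ext a
    obtain ⟨v, rfl⟩ := φ.surjective a
    rw [hτD, hτ]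
    rfl
  set δ := φ (delta0 n d) with hδ
  have hδ_mul (v : Fin n → K) : δ * φ v = φ (d • v) := by
    rw [hδ, ← hφ, delta0_skewMul hn c hdσ]
  have hmul_δ (v : Fin n → K) : φ v * δ = φ (d • v) := by
    rw [hδ, ← hφ, skewMul_delta0 hn]
  have hδ_pow (k : ℕ) (v : Fin n → K) : δ ^ k * φ v = φ (d ^ k • v) := by
    induction k with
    | zero => simp
    | succ k ih => rw [pow_succ', mul_assoc, ih, hδ_mul, smul_smul, ← pow_succ']
  have hδ0 : δ ≠ 0 := by
    rw [hδ, Ne, map_eq_zero_iff _ φ.injective, delta0_eq hn, Pi.single_eq_zero_iff]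
    exact hd0
  have hδinj : Function.Injective fun l : Fin m => (τD ^ (l : ℕ)) δ := by
    intro k l hkl
    simp only [hδ, hτD] at hkl
    refine hτinj ?_
    simpa [delta0] using congrFun (φ.injective hkl) ⟨0, hn⟩
  intro x y hx hy hxy
  have hne {x : Fin n → Fin m → K} (hx : x ≠ 0) : (fun j => φ fun i => x i j) ≠ 0 := by
    refine fun h => hx ?_
    ext i j
    exact congrFun ((map_eq_zero_iff _ φ.injective).1 (congrFun h j)) i
  refine skewMul_ne_zero hτDm hδ0 (fun a => ?_) hδinj (hne hx) (hne hy) ?_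
  · obtain ⟨v, rfl⟩ := φ.surjective a
    rw [hδ_mul, hmul_δ]
  ext s
  have hs : (fun r => tenMul n m σ τ c d x y r s) = ∑ j : Fin m, ∑ l : Fin m,
      if ((j : ℕ) + (l : ℕ)) % m = (s : ℕ) then d ^ (((j : ℕ) + (l : ℕ)) / m) •
        skewMul n σ c (fun i => (τ ^ (l : ℕ)) (x i j)) (fun i => y i l) else 0 := by
    ext r
    simp only [tenMul, Finset.sum_apply, apply_ite (fun f : Fin n → K => f r), Pi.smul_apply,
      Pi.zero_apply, skewMul_apply, smul_eq_mul]
    rw [Finset.sum_comm]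
    refine Finset.sum_congr rfl fun j _ => ?_
    refine ((Finset.sum_congr rfl fun i _ => Finset.sum_comm).trans Finset.sum_comm).trans
      (Finset.sum_congr rfl fun l _ => ?_)
    split_ifs with h
    · simp only [h, and_true, Finset.mul_sum, mul_ite, mul_zero]
      refine Finset.sum_congr rfl fun i _ => Finset.sum_congr rfl fun k _ => ?_
      congr 1
      ring
    · simp [h]
  have hzero : φ (fun r => tenMul n m σ τ c d x y r s) = 0 :=
    (map_eq_zero_iff _ φ.injective).2 (congrArg (fun (f : Fin n → Fin m → K) r => f r s) hxy)
  refine (skewMul_apply m τD δ _ _ s).trans (Eq.trans ?_ hzero)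
  rw [hs]
  simp only [map_sum, apply_ite φ, map_zero, ← hδ_pow, hφ, hτD, mul_assoc]
end

section
/- Suppose d ∈ F ∖ F₀, D = (K/F,σ,c) is a division algebra, m is prime, and, in case m ≠ 2 and m ≠ 3, F₀ contains a primitive m-th root of unity. If dⁿ ∉ F₀, then the tensor product algebra A = (L/F₀,σ,c) ⊗_{F₀} (F/F₀,τ,d) is a division algebra. -/
section CyclicTensor

open Finset

variable {K : Type*} [Field K] (n m : ℕ) (σ τ : K ≃+* K) (c d : K)

/-- The element `eᵏ fˡ a` for arbitrary exponents `k`, `l`, reduced by `eⁿ = c`, `fᵐ = d`. -/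
def tenMonomial (k l : ℕ) (a : K) : Fin n → Fin m → K :=
  fun r s => if k % n = (r : ℕ) ∧ l % m = (s : ℕ) then c ^ (k / n) * d ^ (l / m) * a else 0

lemma tenMonomial_add (k l : ℕ) (a b : K) :
    tenMonomial n m c d k l (a + b) = tenMonomial n m c d k l a + tenMonomial n m c d k l b := by
  funext r s
  simp only [tenMonomial, Pi.add_apply]
  split_ifs <;> ring

lemma tenMonomial_smul (k l : ℕ) (a b : K) :
    tenMonomial n m c d k l (a * b) = a • tenMonomial n m c d k l b := by
  funext r s
  simp only [tenMonomial, Pi.smul_apply, smul_eq_mul]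
  split_ifs <;> ring

variable {n m}

lemma tenMonomial_add_left (hn : 0 < n) (k l q : ℕ) (a : K) :
    tenMonomial n m c d (k + n * q) l a = tenMonomial n m c d k l (c ^ q * a) := by
  funext r s
  simp only [tenMonomial, Nat.add_mul_mod_self_left, Nat.add_mul_div_left _ _ hn, pow_add]
  split_ifs <;> ring

lemma tenMonomial_add_right (hm : 0 < m) (k l q : ℕ) (a : K) :
    tenMonomial n m c d k (l + m * q) a = tenMonomial n m c d k l (d ^ q * a) := by
  funext r s
  simp only [tenMonomial, Nat.add_mul_mod_self_left, Nat.add_mul_div_left _ _ hm, pow_add]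
  split_ifs <;> ring

lemma tenMonomial_apply (i r : Fin n) (j s : Fin m) (a : K) :
    tenMonomial n m c d i j a r s = if i = r ∧ j = s then a else 0 := by
  simp [tenMonomial, Nat.mod_eq_of_lt, Nat.div_eq_of_lt, Fin.ext_iff]

lemma sum_tenMonomial (z : Fin n → Fin m → K) :
    ∑ i : Fin n, ∑ j : Fin m, tenMonomial n m c d i j (z i j) = z := by
  funext r s
  simp only [Finset.sum_apply, tenMonomial_apply, ite_and]
  simp

variable (n m)

/-- Left multiplication by `eⁱ fʲ b`, as a `K`-linear map for the right `K`-structure. -/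
def tenLeft (i j : ℕ) (b : K) : (Fin n → Fin m → K) →ₗ[K] (Fin n → Fin m → K) where
  toFun z := ∑ k : Fin n, ∑ l : Fin m,
    tenMonomial n m c d (i + k) (j + l) ((σ ^ (k : ℕ)) ((τ ^ (l : ℕ)) b) * z k l)
  map_add' x y := by
    simp only [Pi.add_apply, mul_add, tenMonomial_add, sum_add_distrib]
  map_smul' a x := by
    simp only [Pi.smul_apply, smul_eq_mul, mul_left_comm _ a, tenMonomial_smul n m c d _ _ a,
      Finset.smul_sum, RingHom.id_apply]

lemma tenLeft_add (i j : ℕ) (a b : K) :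
    tenLeft n m σ τ c d i j (a + b) = tenLeft n m σ τ c d i j a + tenLeft n m σ τ c d i j b := by
  refine LinearMap.ext fun z => ?_
  simp only [tenLeft, map_add, add_mul, tenMonomial_add, sum_add_distrib, LinearMap.coe_mk,
    AddHom.coe_mk, LinearMap.add_apply]

lemma tenLeft_zero (i j : ℕ) : tenLeft n m σ τ c d i j 0 = 0 := by
  have h := tenLeft_add n m σ τ c d i j 0 0
  simpa using h

lemma tenLeft_sum {ι : Type*} (t : Finset ι) (i j : ℕ) (g : ι → K) :
    tenLeft n m σ τ c d i j (∑ k ∈ t, g k) = ∑ k ∈ t, tenLeft n m σ τ c d i j (g k) :=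
  map_sum (AddMonoidHom.mk' (tenLeft n m σ τ c d i j) (tenLeft_add n m σ τ c d i j)) g t

lemma tenMul_eq_sum_tenLeft (x y : Fin n → Fin m → K) :
    tenMul n m σ τ c d x y = ∑ i : Fin n, ∑ j : Fin m, tenLeft n m σ τ c d i j (x i j) y := by
  funext r s
  simp only [tenMul, tenLeft, LinearMap.coe_mk, AddHom.coe_mk, Finset.sum_apply, tenMonomial,
    mul_assoc]

variable {n m σ τ c d}

lemma pow_mod_apply {p : ℕ} {ρ : K ≃+* K} (h : ρ ^ p = 1) (k : ℕ) : ρ ^ (k % p) = ρ ^ k := by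
  conv_rhs => rw [← Nat.mod_add_div k p, pow_add, pow_mul, h, one_pow, mul_one]

lemma tenLeft_tenMonomial (hn : 0 < n) (hm : 0 < m) (hσ : σ ^ n = 1) (hτ : τ ^ m = 1)
    (i j k l : ℕ) (a b : K) :
    tenLeft n m σ τ c d i j b (tenMonomial n m c d k l a) =
      tenMonomial n m c d (i + k) (j + l) ((σ ^ k) ((τ ^ l) b) * a) := by
  have key : ∀ (k : Fin n) (l : Fin m) (a : K),
      tenLeft n m σ τ c d i j b (tenMonomial n m c d k l a) =
      tenMonomial n m c d (i + k) (j + l) ((σ ^ (k : ℕ)) ((τ ^ (l : ℕ)) b) * a) := by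
    intro k l a
    simp only [tenLeft, LinearMap.coe_mk, AddHom.coe_mk, tenMonomial_apply]
    rw [Finset.sum_eq_single k, Finset.sum_eq_single l]
    · simp
    · intro q _ hq
      rw [if_neg (fun h => hq h.2.symm), mul_zero]
      funext r s; simp [tenMonomial]
    · simp
    · intro q _ hq
      refine Finset.sum_eq_zero fun p _ => ?_
      rw [if_neg (fun h => hq h.1.symm), mul_zero]
      funext r s; simp [tenMonomial]
    · simp
  have h1 := key ⟨k % n, Nat.mod_lt _ hn⟩ ⟨l % m, Nat.mod_lt _ hm⟩
    (c ^ (k / n) * (d ^ (l / m) * a))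
  have e : tenMonomial n m c d k l a =
      tenMonomial n m c d (k % n) (l % m) (c ^ (k / n) * (d ^ (l / m) * a)) := by
    rw [← tenMonomial_add_left c d hn, ← tenMonomial_add_right c d hm, Nat.mod_add_div,
      Nat.mod_add_div]
  rw [e]
  refine h1.trans ?_
  simp only [pow_mod_apply hσ, pow_mod_apply hτ]
  conv_rhs => rw [← Nat.mod_add_div k n, ← Nat.mod_add_div l m, ← add_assoc, ← add_assoc,
    tenMonomial_add_left c d hn, tenMonomial_add_right c d hm]
  congr 1
  rw [Nat.mod_add_div, Nat.mod_add_div]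
  ring

lemma linearMap_ext_tenMonomial {f g : (Fin n → Fin m → K) →ₗ[K] (Fin n → Fin m → K)}
    (c d : K)
    (h : ∀ (k l : ℕ) (a : K), f (tenMonomial n m c d k l a) = g (tenMonomial n m c d k l a)) :
    f = g := by
  refine LinearMap.ext fun z => ?_
  rw [← sum_tenMonomial c d z]
  simp only [map_sum, h]

lemma tenLeft_mul (hn : 0 < n) (hm : 0 < m) (hσ : σ ^ n = 1) (hτ : τ ^ m = 1)
    (hcomm : σ * τ = τ * σ) (i j k l : ℕ) (a b : K) :
    tenLeft n m σ τ c d i j a * tenLeft n m σ τ c d k l b =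
      tenLeft n m σ τ c d (i + k) (j + l) ((σ ^ k) ((τ ^ l) a) * b) := by
  refine linearMap_ext_tenMonomial c d fun p q z => ?_
  simp only [Module.End.mul_apply, tenLeft_tenMonomial hn hm hσ hτ, map_mul, add_assoc, mul_assoc]
  congr 2
  have h : τ ^ q * σ ^ k = σ ^ k * τ ^ q := ((show Commute σ τ from hcomm).pow_pow k q).symm
  have h' := DFunLike.congr_fun h ((τ ^ l) a)
  simp only [RingAut.mul_apply] at h'
  rw [h', add_comm k, add_comm l, pow_add, pow_add]
  rfl

lemma tenLeft_one (hn : 0 < n) (hm : 0 < m) (hσ : σ ^ n = 1) (hτ : τ ^ m = 1) :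
    tenLeft n m σ τ c d 0 0 1 = 1 := by
  refine linearMap_ext_tenMonomial c d fun p q z => ?_
  simp [tenLeft_tenMonomial hn hm hσ hτ]

lemma tenLeft_mod (hn : 0 < n) (hm : 0 < m) (hσ : σ ^ n = 1) (hτ : τ ^ m = 1)
    (hcσ : σ c = c) (hcτ : τ c = c) (i j : ℕ) (b : K) :
    tenLeft n m σ τ c d i j b = tenLeft n m σ τ c d (i % n) j (c ^ (i / n) * b) := by
  have fix : ∀ {ρ : K ≃+* K}, ρ c = c → ∀ k, (ρ ^ k) c = c := by
    intro ρ h k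
    induction k with
    | zero => rfl
    | succ k ih => rw [pow_succ, RingAut.mul_apply, h, ih]
  refine linearMap_ext_tenMonomial c d fun p q z => ?_
  simp only [tenLeft_tenMonomial hn hm hσ hτ, map_mul, map_pow, fix hcσ, fix hcτ]
  conv_lhs => rw [← Nat.mod_add_div i n, add_right_comm, tenMonomial_add_left c d hn]
  rw [mul_assoc]

lemma tenLeft_scalar_apply (hn : 0 < n) (hm : 0 < m) (hσ : σ ^ n = 1) (hτ : τ ^ m = 1)
    (b : K) (z : Fin n → Fin m → K) (k : Fin n) (l : Fin m) :
    tenLeft n m σ τ c d 0 0 b z k l = (σ ^ (k : ℕ)) ((τ ^ (l : ℕ)) b) * z k l := by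
  conv_lhs => rw [← sum_tenMonomial c d z]
  simp only [map_sum, tenLeft_tenMonomial hn hm hσ hτ, zero_add]
  rw [sum_tenMonomial c d fun k l => (σ ^ (k : ℕ)) ((τ ^ (l : ℕ)) b) * z k l]

lemma tenLeft_pow_right (hn : 0 < n) (hm : 0 < m) (hσ : σ ^ n = 1) (hτ : τ ^ m = 1)
    (z : Fin n → Fin m → K) : tenLeft n m σ τ c d 0 m 1 z = d • z := by
  have : tenLeft n m σ τ c d 0 m 1 = d • 1 := by
    refine linearMap_ext_tenMonomial c d fun p q a => ?_
    rw [tenLeft_tenMonomial hn hm hσ hτ]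
    have := tenMonomial_add_right (n := n) c d hm p q 1 a
    simp only [mul_one, pow_one] at this
    simp [add_comm m, this, tenMonomial_smul]
  simp [this]

variable (n m σ τ c d) in
/-- Left multiplication by the element `∑ eⁱ uᵢ` of the cyclic algebra `(K/F,σ,c)`. -/
def cycLeft (u : Fin n → K) : (Fin n → Fin m → K) →ₗ[K] (Fin n → Fin m → K) :=
  ∑ i : Fin n, tenLeft n m σ τ c d i 0 (u i)

lemma cycLeft_mul (hn : 0 < n) (hm : 0 < m) (hσ : σ ^ n = 1) (hτ : τ ^ m = 1)
    (hcomm : σ * τ = τ * σ) (hcσ : σ c = c) (hcτ : τ c = c) (u v : Fin n → K) :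
    cycLeft n m σ τ c d u * cycLeft n m σ τ c d v = cycLeft n m σ τ c d (cycMul n σ c u v) := by
  simp only [cycLeft, cycMul, Finset.sum_mul_sum, tenLeft_mul hn hm hσ hτ hcomm, tenLeft_sum]
  symm
  rw [Finset.sum_comm]
  refine Finset.sum_congr rfl fun i _ => ?_
  rw [Finset.sum_comm]
  refine Finset.sum_congr rfl fun k _ => ?_
  rw [Finset.sum_eq_single ⟨((i : ℕ) + k) % n, Nat.mod_lt _ hn⟩]
  · rw [if_pos rfl, tenLeft_mod hn hm hσ hτ hcσ hcτ (i + k)]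
    simp [mul_assoc]
  · intro r _ hr
    rw [if_neg (fun h => hr (Fin.ext h.symm)), tenLeft_zero]
  · simp

lemma cycLeft_delta0 (hn : 0 < n) (hm : 0 < m) (hσ : σ ^ n = 1) (hτ : τ ^ m = 1) :
    cycLeft n m σ τ c d (delta0 n 1) = 1 := by
  rw [cycLeft, Finset.sum_eq_single ⟨0, hn⟩, ← tenLeft_one (c := c) (d := d) hn hm hσ hτ]
  · simp [delta0]
  · intro r _ hr
    rw [delta0, if_neg (fun h => hr (Fin.ext h)), tenLeft_zero]
  · simp

lemma exists_cycMul_eq (hD : ∀ x y : Fin n → K, x ≠ 0 → y ≠ 0 → cycMul n σ c x y ≠ 0)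
    {u : Fin n → K} (hu : u ≠ 0) (w : Fin n → K) : ∃ v, cycMul n σ c u v = w := by
  let f : (Fin n → K) →ₗ[K] (Fin n → K) :=
    { toFun := cycMul n σ c u
      map_add' := fun x y => by
        funext r
        simp only [cycMul, Pi.add_apply, ← sum_add_distrib]
        refine sum_congr rfl fun i _ => sum_congr rfl fun k _ => ?_
        split_ifs <;> ring
      map_smul' := fun a x => by
        funext r
        simp only [cycMul, Pi.smul_apply, smul_eq_mul, mul_sum, RingHom.id_apply]
        refine sum_congr rfl fun i _ => sum_congr rfl fun k _ => ?_
        split_ifs <;> ring }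
  have hf : Function.Injective f := by
    rw [injective_iff_map_eq_zero]
    intro v hv
    by_contra h
    exact hD u v hu h hv
  exact LinearMap.injective_iff_surjective.mp hf w

lemma exists_cycLeft_mul_eq_one (hn : 0 < n) (hm : 0 < m) (hσ : σ ^ n = 1) (hτ : τ ^ m = 1)
    (hcomm : σ * τ = τ * σ) (hcσ : σ c = c) (hcτ : τ c = c)
    (hD : ∀ x y : Fin n → K, x ≠ 0 → y ≠ 0 → cycMul n σ c x y ≠ 0)
    {u : Fin n → K} (hu : u ≠ 0) :
    ∃ v, cycLeft n m σ τ c d v * cycLeft n m σ τ c d u = 1 := by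
  have key : ∀ {u : Fin n → K}, u ≠ 0 → ∃ v, v ≠ 0 ∧
      cycLeft n m σ τ c d u * cycLeft n m σ τ c d v = 1 := by
    intro u hu
    obtain ⟨v, hv⟩ := exists_cycMul_eq hD hu (delta0 n 1)
    refine ⟨v, ?_, by rw [cycLeft_mul hn hm hσ hτ hcomm hcσ hcτ, hv, cycLeft_delta0 hn hm hσ hτ]⟩
    rintro rfl
    have := congrFun hv ⟨0, hn⟩
    simp [cycMul, delta0] at this
  obtain ⟨v, hv0, hv⟩ := key hu
  obtain ⟨w, -, hw⟩ := key hv0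
  exact ⟨v, by rwa [left_inv_eq_right_inv hv hw]⟩

lemma tenMul_injective_of_surjective (hn : 0 < n) (hm : 0 < m) (hσ : σ ^ n = 1)
    (hτ : τ ^ m = 1) (hcomm : σ * τ = τ * σ) {y : Fin n → Fin m → K}
    (hy : ∀ w, ∃ x, tenMul n m σ τ c d x y = w) {x : Fin n → Fin m → K}
    (hx : tenMul n m σ τ c d x y = 0) : x = 0 := by
  let φ : ℕ → ℕ → K ≃+* K := fun k l => σ ^ k * τ ^ l
  let f : (Fin n → Fin m → K) →ₗ[K] (Fin n → Fin m → K) :=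
    { toFun := fun x k l => ∑ i : Fin n, ∑ j : Fin m,
        x i j * (φ k l).symm (tenLeft n m σ τ c d i j 1 y k l)
      map_add' := fun x y => by
        funext k l
        simp only [Pi.add_apply, add_mul, sum_add_distrib]
      map_smul' := fun a x => by
        funext k l
        simp only [Pi.smul_apply, smul_eq_mul, mul_sum, RingHom.id_apply, mul_assoc] }
  have hf : ∀ x (k : Fin n) (l : Fin m), φ k l (f x k l) =
      tenMul n m σ τ c d (fun i j => φ i j (x i j)) y k l := by
    intro x k l
    rw [tenMul_eq_sum_tenLeft]
    simp only [f, LinearMap.coe_mk, AddHom.coe_mk, map_sum, map_mul, RingEquiv.apply_symm_apply,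
      Finset.sum_apply]
    refine sum_congr rfl fun i _ => sum_congr rfl fun j _ => ?_
    have h := tenLeft_mul (c := c) (d := d) hn hm hσ hτ hcomm 0 0 i j (x i j) 1
    simp only [zero_add, mul_one] at h
    change _ = tenLeft n m σ τ c d i j ((σ ^ (i : ℕ)) ((τ ^ (j : ℕ)) (x i j))) y k l
    rw [← h, Module.End.mul_apply, tenLeft_scalar_apply hn hm hσ hτ]
    rfl
  have hsurj : Function.Surjective f := by
    intro w
    obtain ⟨x, hx⟩ := hy fun k l => φ k l (w k l)
    refine ⟨fun i j => (φ i j).symm (x i j), ?_⟩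
    funext k l
    apply (φ k l).injective
    rw [hf]
    simp only [RingEquiv.apply_symm_apply]
    rw [hx]
  have hinj := LinearMap.injective_iff_surjective.mpr hsurj
  have h0 : (fun i j => (φ i j).symm (x i j) : Fin n → Fin m → K) = 0 := by
    apply (injective_iff_map_eq_zero f).mp hinj
    funext k l
    apply (φ k l).injective
    rw [hf]
    simp only [RingEquiv.apply_symm_apply]
    simp [hx]
  funext i j
  have := congrFun (congrFun h0 i) j
  simpa using this

lemma pow_apply_ne_of_not_dvd (hmp : m.Prime) (hτ : τ ^ m = 1) (hdτ : τ d ≠ d) {p : ℕ}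
    (hp : ¬ m ∣ p) : (τ ^ p) d ≠ d := by
  intro h
  have hmem : ∀ q, (τ ^ q) d = d → Function.IsPeriodicPt τ q d := by
    intro q hq
    have : ∀ q, (τ ^ q) d = τ^[q] d := by
      intro q
      induction q with
      | zero => rfl
      | succ q ih => rw [pow_succ', RingAut.mul_apply, ih, Function.iterate_succ_apply']
    rw [Function.IsPeriodicPt, Function.IsFixedPt, ← this, hq]
  have hg := (hmem m (by rw [hτ]; rfl)).gcd (hmem p h)
  rw [(Nat.Prime.coprime_iff_not_dvd hmp).mpr hp] at hg
  exact hdτ hg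

/-- A nonzero additive subgroup of the tensor product stable under all left multiplications
is everything. -/
lemma eq_top_of_tenLeft_stable (hn : 0 < n) (hmp : m.Prime) (hσ : σ ^ n = 1) (hτ : τ ^ m = 1)
    (hcomm : σ * τ = τ * σ) (hcσ : σ c = c) (hcτ : τ c = c)
    (hD : ∀ x y : Fin n → K, x ≠ 0 → y ≠ 0 → cycMul n σ c x y ≠ 0)
    (hd0 : d ≠ 0) (hdσ : σ d = d) (hdτ : τ d ≠ d) (W : AddSubgroup (Fin n → Fin m → K))
    (hW : ∀ i j b, ∀ w ∈ W, tenLeft n m σ τ c d i j b w ∈ W) {y : Fin n → Fin m → K}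
    (hyW : y ∈ W) (hy : y ≠ 0) : W = ⊤ := by
  have hm := hmp.pos
  obtain ⟨a, ha⟩ := Function.ne_iff.mp hy
  obtain ⟨s, has⟩ := Function.ne_iff.mp ha
  have hproj : ∀ S : Finset (Fin m), s ∉ S →
      ∃ w ∈ W, w a s ≠ 0 ∧ ∀ k, ∀ l ∈ S, w k l = 0 := by
    intro S
    induction S using Finset.induction_on with
    | empty => exact fun _ => ⟨y, hyW, has, by simp⟩
    | insert j S _ ih =>
      intro hs
      simp only [Finset.mem_insert, not_or] at hs
      obtain ⟨w, hwW, hwa, hwS⟩ := ih hs.2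
      have hval : ∀ k l, (tenLeft n m σ τ c d 0 0 ((τ ^ (m - (j : ℕ))) d) w
          - tenLeft n m σ τ c d 0 m 1 w) k l
          = ((τ ^ ((l : ℕ) + (m - j))) d - d) * w k l := by
        intro k l
        rw [tenLeft_pow_right hn hm hσ hτ]
        simp only [Pi.sub_apply, tenLeft_scalar_apply hn hm hσ hτ, Pi.smul_apply, smul_eq_mul]
        rw [← RingAut.mul_apply (τ ^ (l : ℕ)), ← pow_add, ← RingAut.mul_apply (σ ^ (k : ℕ)),
          (show Commute σ τ from hcomm).pow_pow, RingAut.mul_apply]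
        have : (σ ^ (k : ℕ)) d = d := by
          generalize (k : ℕ) = q
          induction q with
          | zero => rfl
          | succ q ih => rw [pow_succ, RingAut.mul_apply, hdσ, ih]
        rw [this, sub_mul]
      refine ⟨_, W.sub_mem (hW 0 0 ((τ ^ (m - (j : ℕ))) d) w hwW) (hW 0 m 1 w hwW), ?_, ?_⟩
      · rw [hval]
        refine mul_ne_zero (sub_ne_zero.mpr (pow_apply_ne_of_not_dvd hmp hτ hdτ ?_)) hwa
        have hsj : (s : ℕ) ≠ j := fun h => hs.1 (Fin.ext h)
        have := s.2
        have := j.2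
        rintro ⟨q, hq⟩
        have h1 : q < 2 := by
          by_contra! h
          have := Nat.mul_le_mul_left m h
          omega
        interval_cases q <;> omega
      · intro k l hl
        rw [hval]
        rcases Finset.mem_insert.mp hl with rfl | hl
        · have : (l : ℕ) + (m - l) = m := by have := l.2; omega
          rw [this, hτ]
          simp
        · rw [hwS k l hl, mul_zero]
  obtain ⟨w, hwW, hwa, hw0⟩ := hproj (Finset.univ.erase s) (by simp)
  have hw : w = ∑ i : Fin n, tenMonomial n m c d i s (w i s) := by
    conv_lhs => rw [← sum_tenMonomial c d w]
    refine sum_congr rfl fun i _ => Finset.sum_eq_single s (fun j _ hj => ?_) (by simp)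
    rw [hw0 i j (by simp [hj])]
    funext r t
    simp [tenMonomial]
  have hshift : tenLeft n m σ τ c d 0 (m - s) 1 w =
      cycLeft n m σ τ c d (fun i => d * w i s) (tenMonomial n m c d 0 0 1) := by
    conv_lhs => rw [hw]
    simp only [cycLeft, map_sum, LinearMap.sum_apply, tenLeft_tenMonomial hn hm hσ hτ]
    refine sum_congr rfl fun i _ => ?_
    have := tenMonomial_add_right (n := n) c d hm i 0 1 (w i s)
    have hs : m - (s : ℕ) + s = 0 + m * 1 := by have := s.2; omega
    simpa [hs] using this
  obtain ⟨v, hv⟩ := exists_cycLeft_mul_eq_one (d := d) hn hm hσ hτ hcomm hcσ hcτ hD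
    (u := fun i => d * w i s) (Function.ne_iff.mpr ⟨a, mul_ne_zero hd0 hwa⟩)
  have hone : tenMonomial n m c d 0 0 1 ∈ W := by
    have h : cycLeft n m σ τ c d v (tenLeft n m σ τ c d 0 (m - s) 1 w) ∈ W := by
      rw [cycLeft, LinearMap.sum_apply]
      exact W.sum_mem fun i _ => hW _ _ _ _ (hW _ _ _ _ hwW)
    rwa [hshift, ← Module.End.mul_apply, hv] at h
  rw [eq_top_iff]
  intro z _
  rw [← sum_tenMonomial c d z]
  refine W.sum_mem fun i _ => W.sum_mem fun j _ => ?_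
  have := hW i j (z i j) _ hone
  simpa [tenLeft_tenMonomial hn hm hσ hτ] using this

end CyclicTensor

/-- Suppose `d ∈ F ∖ F₀`, `D = (K/F,σ,c)` is a division algebra, `m` is
prime, and, in case `m ≠ 2, 3`, `F₀` contains a primitive `m`-th root of unity. If
`dⁿ ∉ F₀` (`F₀` being the common fixed field of `σ` and `τ`), then
`A = (L/F₀,σ,c) ⊗_{F₀} (F/F₀,τ,d)` is a division algebra. -/
theorem tensor_division_of_pow_not_in_base {K : Type*} [Field K] (n m : ℕ)
    (hn : 0 < n) (hmp : m.Prime)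
    (σ τ : K ≃+* K) (hσord : orderOf σ = n) (hτord : orderOf τ = m)
    (hcomm : σ * τ = τ * σ)
    (hindep : ∀ i j : ℕ, i < n → j < m → σ ^ i * τ ^ j = 1 → i = 0 ∧ j = 0)
    (hroot : m ≠ 2 → m ≠ 3 → ∃ ζ : K, σ ζ = ζ ∧ τ ζ = ζ ∧ ζ ^ m = 1 ∧
      ∀ k : ℕ, 0 < k → k < m → ζ ^ k ≠ 1)
    (c : K) (hc0 : c ≠ 0) (hcσ : σ c = c) (hcτ : τ c = c)
    (d : K) (hd0 : d ≠ 0) (hdσ : σ d = d) (hdτ : τ d ≠ d)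
    (hD : ∀ x y : Fin n → K, x ≠ 0 → y ≠ 0 → cycMul n σ c x y ≠ 0)
    (hdn : ¬ (σ (d ^ n) = d ^ n ∧ τ (d ^ n) = d ^ n)) :
    ∀ x y : Fin n → Fin m → K, x ≠ 0 → y ≠ 0 → tenMul n m σ τ c d x y ≠ 0 := by
  have hm := hmp.pos
  have hσ : σ ^ n = 1 := hσord ▸ pow_orderOf_eq_one σ
  have hτ : τ ^ m = 1 := hτord ▸ pow_orderOf_eq_one τ
  intro x y hx hy hxy
  let R : (Fin n → Fin m → K) →+ (Fin n → Fin m → K) :=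
    AddMonoidHom.mk' (fun x => tenMul n m σ τ c d x y) fun a b => by
      simp only [tenMul_eq_sum_tenLeft, Pi.add_apply, tenLeft_add, LinearMap.add_apply,
        Finset.sum_add_distrib]
  let W : AddSubgroup (Fin n → Fin m → K) := R.range
  have hlow : ∀ i j b, j < m → tenLeft n m σ τ c d i j b y ∈ W := by
    intro i j b hj
    rw [tenLeft_mod hn hm hσ hτ hcσ hcτ]
    refine ⟨tenMonomial n m c d (i % n) j (c ^ (i / n) * b), ?_⟩
    have hmon := fun k (l : Fin m) => tenMonomial_apply c d ⟨i % n, Nat.mod_lt _ hn⟩ k ⟨j, hj⟩ l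
    change tenMul n m σ τ c d _ y = _
    rw [tenMul_eq_sum_tenLeft, Finset.sum_eq_single ⟨i % n, Nat.mod_lt _ hn⟩,
      Finset.sum_eq_single ⟨j, hj⟩]
    · rw [hmon, if_pos ⟨rfl, rfl⟩]
    · intro l _ hl
      rw [hmon, if_neg (fun h => hl h.2.symm), tenLeft_zero, LinearMap.zero_apply]
    · simp
    · intro k _ hk
      refine Finset.sum_eq_zero fun l _ => ?_
      rw [hmon, if_neg (fun h => hk h.1.symm), tenLeft_zero, LinearMap.zero_apply]
    · simp
  have hWmem : ∀ w ∈ W, ∃ x : Fin n → Fin m → K,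
      w = ∑ i : Fin n, ∑ j : Fin m, tenLeft n m σ τ c d i j (x i j) y := by
    rintro w ⟨x, rfl⟩
    exact ⟨x, tenMul_eq_sum_tenLeft n m σ τ c d x y⟩
  have hD0 : ∀ i b, ∀ w ∈ W, tenLeft n m σ τ c d i 0 b w ∈ W := by
    intro i b w hw
    obtain ⟨x, rfl⟩ := hWmem w hw
    simp only [map_sum, ← Module.End.mul_apply, tenLeft_mul hn hm hσ hτ hcomm, zero_add]
    exact W.sum_mem fun k _ => W.sum_mem fun l _ => hlow _ _ _ l.2
  obtain ⟨k, ⟨a, hak⟩, hkmax⟩ : ∃ k : Fin m, (∃ a, x a k ≠ 0) ∧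
      ∀ l, k < l → ∀ i, x i l = 0 := by
    classical
    let S : Finset (Fin m) := Finset.univ.filter fun k => ∃ a, x a k ≠ 0
    have hS : S.Nonempty := by
      obtain ⟨a, ha⟩ := Function.ne_iff.mp hx
      obtain ⟨k, hk⟩ := Function.ne_iff.mp ha
      exact ⟨k, by simpa [S] using ⟨a, hk⟩⟩
    refine ⟨S.max' hS, by simpa [S] using S.max'_mem hS, fun l hl i => ?_⟩
    by_contra h
    exact absurd (S.le_max' l (by simpa [S] using ⟨i, h⟩)) (not_le.mpr hl)
  have hall : ∀ j i b, tenLeft n m σ τ c d i j b y ∈ W := by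
    intro j
    induction j using Nat.strong_induction_on with
    | _ j ih =>
      by_cases hj : j < m
      · exact fun i b => hlow i j b hj
      have hkj : (k : ℕ) ≤ j := by have := k.2; omega
      have htop : ∑ i : Fin n, tenLeft n m σ τ c d i j (x i k) y ∈ W := by
        have h0 : tenLeft n m σ τ c d 0 (j - k) 1 (tenMul n m σ τ c d x y) = 0 := by
          rw [hxy, map_zero]
        rw [tenMul_eq_sum_tenLeft, Finset.sum_comm] at h0
        simp only [map_sum, ← Module.End.mul_apply, tenLeft_mul hn hm hσ hτ hcomm, zero_add,
          map_one, one_mul] at h0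
        rw [← Finset.add_sum_erase _ _ (Finset.mem_univ k), Nat.sub_add_cancel hkj] at h0
        rw [eq_neg_of_add_eq_zero_left h0]
        refine W.neg_mem (W.sum_mem fun l hl => W.sum_mem fun i _ => ?_)
        rcases lt_or_gt_of_ne (Finset.ne_of_mem_erase hl) with h | h
        · exact ih _ (by have : (l : ℕ) < k := h; omega) _ _
        · rw [hkmax l h i, tenLeft_zero]
          exact W.zero_mem
      have hfac : ∀ i b, tenLeft n m σ τ c d i j b =
          tenLeft n m σ τ c d i 0 ((τ ^ j).symm b) * tenLeft n m σ τ c d 0 j 1 := by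
        intro i b
        rw [tenLeft_mul hn hm hσ hτ hcomm]
        simp
      obtain ⟨v, hv⟩ := exists_cycLeft_mul_eq_one (d := d) hn hm hσ hτ hcomm hcσ hcτ hD
        (u := fun i => (τ ^ j).symm (x i k)) (Function.ne_iff.mpr ⟨a, by simpa using hak⟩)
      have hbase : tenLeft n m σ τ c d 0 j 1 y ∈ W := by
        have h1 : ∑ i : Fin n, tenLeft n m σ τ c d i j (x i k) y =
            cycLeft n m σ τ c d (fun i => (τ ^ j).symm (x i k))
              (tenLeft n m σ τ c d 0 j 1 y) := by
          simp only [cycLeft, LinearMap.sum_apply, ← Module.End.mul_apply, ← hfac]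
        have h2 : cycLeft n m σ τ c d v
            (∑ i : Fin n, tenLeft n m σ τ c d i j (x i k) y) ∈ W := by
          rw [cycLeft, LinearMap.sum_apply]
          exact W.sum_mem fun i _ => hD0 _ _ _ htop
        rwa [h1, ← Module.End.mul_apply, hv] at h2
      intro i b
      rw [hfac, Module.End.mul_apply]
      exact hD0 _ _ _ hbase
  have hW : ∀ i j b, ∀ w ∈ W, tenLeft n m σ τ c d i j b w ∈ W := by
    intro i j b w hw
    obtain ⟨x, rfl⟩ := hWmem w hw
    simp only [map_sum, ← Module.End.mul_apply, tenLeft_mul hn hm hσ hτ hcomm]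
    exact W.sum_mem fun k _ => W.sum_mem fun l _ => hall _ _ _
  have hyW : y ∈ W := by
    have := hlow 0 0 1 hm
    rwa [tenLeft_one hn hm hσ hτ] at this
  have htop := eq_top_of_tenLeft_stable hn hmp hσ hτ hcomm hcσ hcτ hD hd0 hdσ hdτ W hW hyW hy
  refine hx (tenMul_injective_of_surjective hn hm hσ hτ hcomm (fun w => ?_) hxy)
  have hw : w ∈ W := htop ▸ AddSubgroup.mem_top w
  exact hw
end
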